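/- For every real k, every 0 < p ≤ 1 with q = 1 − p, and every complex z with |z| < 1, one has the four identities P̂_{1,1}(k,z) = −q/p + (1 − Q̂_{2,2}(k,z))/(p·det(I − Q(k,z))), P̂_{1,2}(k,z) = Q̂_{1,2}(k,z)/(p·det(I − Q(k,z))), P̂_{2,1}(k,z) = Q̂_{2,1}(k,z)/(p·det(I − Q(k,z))), and P̂_{2,2}(k,z) = −q/p + (1 − Q̂_{1,1}(k,z))/(p·det(I − Q(k,z))); consequently each function z ↦ P̂_{m,n}(k,z), analytic on the unit disk, extends to a meromorphic function on the disk |z| < 1/q. -/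

import Mathlib

noncomputable section

open Complex Filter

/-- Amplitude functions on the position × coin space `ℤ × {1,2}`
(coin `0` = "right", coin `1` = "left"). -/
abbrev QState := ℤ × Fin 2 → ℂ

/-- One step of the Hadamard walk: `(hadamardStep ψ) (x,n) = ⟨x,n|U ψ⟩`, where `U = S ∘ C`
with `S` the chirality-conditioned shift and `C` the Hadamard coin. -/
def hadamardStep (ψ : QState) : QState := fun v =>
  if v.2 = 0 then (ψ (v.1 - 1, 0) + ψ (v.1 - 1, 1)) / (Real.sqrt 2 : ℂ)
  else (ψ (v.1 + 1, 0) - ψ (v.1 + 1, 1)) / (Real.sqrt 2 : ℂ)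

/-- The basis state `|x,n⟩`. -/
def ket (x : ℤ) (n : Fin 2) : QState := fun v => if v = (x, n) then 1 else 0

/-- Pure Hadamard-walk probabilities `W_{m,n}(x,t) = |⟨x,n|U^t|0,m⟩|²`. -/
def W (m n : Fin 2) (x : ℤ) (t : ℕ) : ℝ := ‖(hadamardStep^[t] (ket 0 m)) (x, n)‖ ^ 2

/-- Measurement operators, indexed by `𝔸 = {c} ∪ ℤ×{1,2}`:
`none` is the coherent projection `A_c = √(1-p)·I`, and `some (x,n)` is the
decoherence projection `A_{x,n} = √p |x,n⟩⟨x,n|`. -/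
def measOp (p : ℝ) : Option (ℤ × Fin 2) → QState → QState
  | none => fun ψ v => (Real.sqrt (1 - p) : ℂ) * ψ v
  | some w => fun ψ v => if v = w then (Real.sqrt p : ℂ) * ψ w else 0

/-- The amplitude `(A_{j_t}U)⋯(A_{j_1}U)|0,m⟩` along the path `j`. -/
def pathAmp (p : ℝ) (m : Fin 2) : (t : ℕ) → (Fin t → Option (ℤ × Fin 2)) → QState
  | 0, _ => ket 0 m
  | t + 1, j => measOp p (j (Fin.last t)) (hadamardStep (pathAmp p m t fun i => j i.castSucc))

/-- Decoherent Hadamard-walk probabilities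
`P_{m,n}(x,t) = Σ_{j∈𝔸^t} |⟨x,n|(A_{j_t}U)⋯(A_{j_1}U)|0,m⟩|²`. -/
def Pdec (p : ℝ) (m n : Fin 2) (x : ℤ) (t : ℕ) : ℝ :=
  ∑' j : Fin t → Option (ℤ × Fin 2), ‖pathAmp p m t j (x, n)‖ ^ 2

/-- `Ŵ_{m,n}(k,t) = Σ_x W_{m,n}(x,t) e^{ikx}`. -/
def What (m n : Fin 2) (k : ℝ) (t : ℕ) : ℂ :=
  ∑' x : ℤ, (W m n x t : ℂ) * Complex.exp (Complex.I * k * x)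

/-- `P̂_{m,n}(k,z) = Σ_{t≥0} Σ_x P_{m,n}(x,t) e^{ikx} z^t`. -/
def Phat (p : ℝ) (m n : Fin 2) (k : ℝ) (z : ℂ) : ℂ :=
  ∑' t : ℕ, (∑' x : ℤ, (Pdec p m n x t : ℂ) * Complex.exp (Complex.I * k * x)) * z ^ t

/-- `Q̂_{m,n}(k,z) = (p/q) Σ_{t≥1} Ŵ_{m,n}(k,t) (qz)^t = p Σ_{t≥1} Ŵ_{m,n}(k,t) q^{t-1} z^t`
with `q = 1-p`. -/
def Qhat (p : ℝ) (m n : Fin 2) (k : ℝ) (z : ℂ) : ℂ :=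
  (p : ℂ) * ∑' t : ℕ, What m n k (t + 1) * ((1 - p : ℝ) : ℂ) ^ t * z ^ (t + 1)

/-- The matrix `P(k,z) = (P̂_{m,n}(k,z))`. -/
def Pmat (p k : ℝ) (z : ℂ) : Matrix (Fin 2) (Fin 2) ℂ := Matrix.of fun m n => Phat p m n k z

/-- The matrix `Q(k,z) = (Q̂_{m,n}(k,z))`. -/
def Qmat (p k : ℝ) (z : ℂ) : Matrix (Fin 2) (Fin 2) ℂ := Matrix.of fun m n => Qhat p m n k z

/-- Maximum row-sum norm of a 2×2 complex matrix. -/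
def rowSumNorm (A : Matrix (Fin 2) (Fin 2) ℂ) : ℝ :=
  max (‖A 0 0‖ + ‖A 0 1‖) (‖A 1 0‖ + ‖A 1 1‖)

/-- Distribution of the symmetric decoherent Hadamard walk:
`P(X_t = x) = (1/2) Σ_{m,n} P_{m,n}(x,t)`. -/
def PsymProb (p : ℝ) (x : ℤ) (t : ℕ) : ℝ := (1/2) * ∑ m : Fin 2, ∑ n : Fin 2, Pdec p m n x t

/-- Mean position of the symmetric decoherent walk. -/
def symMean (p : ℝ) (t : ℕ) : ℝ := ∑' x : ℤ, (x : ℝ) * PsymProb p x t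

/-- Variance of the symmetric decoherent walk. -/
def symVar (p : ℝ) (t : ℕ) : ℝ :=
  (∑' x : ℤ, (x : ℝ) ^ 2 * PsymProb p x t) - (∑' x : ℤ, (x : ℝ) * PsymProb p x t) ^ 2

/-- The symmetric generating function `P̂(k,z) = (1/2) Σ_{m,n} P̂_{m,n}(k,z)`. -/
def PhatSym (p k : ℝ) (z : ℂ) : ℂ := (1/2) * ∑ m : Fin 2, ∑ n : Fin 2, Phat p m n k z

/-- Characteristic function `P̂(k,t)` of the symmetric decoherent walk. -/
def charSym (p k : ℝ) (t : ℕ) : ℂ :=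
  ∑' x : ℤ, (PsymProb p x t : ℂ) * Complex.exp (Complex.I * k * x)

/-- Distribution of the decoherent walk started at `|0,1⟩`: `P(X̃_t = x) = Σ_n P_{1,n}(x,t)`. -/
def Ptilde (p : ℝ) (x : ℤ) (t : ℕ) : ℝ := ∑ n : Fin 2, Pdec p 0 n x t

/-- Mean position of the decoherent walk started at `|0,1⟩`. -/
def tildeMean (p : ℝ) (t : ℕ) : ℝ := ∑' x : ℤ, (x : ℝ) * Ptilde p x t

/-- Variance of the decoherent walk started at `|0,1⟩`. -/
def tildeVar (p : ℝ) (t : ℕ) : ℝ :=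
  (∑' x : ℤ, (x : ℝ) ^ 2 * Ptilde p x t) - (∑' x : ℤ, (x : ℝ) * Ptilde p x t) ^ 2

/-- Characteristic function of the decoherent walk started at `|0,1⟩`. -/
def charTilde (p k : ℝ) (t : ℕ) : ℂ :=
  ∑' x : ℤ, (Ptilde p x t : ℂ) * Complex.exp (Complex.I * k * x)

/-- The symmetric initial state `φ₀ = (|0,1⟩ + i|0,2⟩)/√2`. -/
def phi0 : QState := fun v =>
  if v = ((0 : ℤ), (0 : Fin 2)) then (1 / Real.sqrt 2 : ℂ)
  else if v = ((0 : ℤ), (1 : Fin 2)) then Complex.I / Real.sqrt 2 else 0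

/-- Distribution of the pure symmetric Hadamard walk: `P(Q_t = x) = Σ_n |⟨x,n|U^t|φ₀⟩|²`. -/
def Ppure (x : ℤ) (t : ℕ) : ℝ := ∑ n : Fin 2, ‖(hadamardStep^[t] phi0) (x, n)‖ ^ 2

/-- Variance of the pure symmetric Hadamard walk. -/
def pureVar (t : ℕ) : ℝ :=
  (∑' x : ℤ, (x : ℝ) ^ 2 * Ppure x t) - (∑' x : ℤ, (x : ℝ) * Ppure x t) ^ 2

/-- `E(k,z) = √((q²z² − (1+cos k)qz + 1)(q²z² + (1+cos k)qz + 1))`, principal branch. -/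
def Efun (q k : ℝ) (z : ℂ) : ℂ :=
  (((q : ℂ) ^ 2 * z ^ 2 - (1 + (Real.cos k : ℂ)) * (q : ℂ) * z + 1) *
    ((q : ℂ) ^ 2 * z ^ 2 + (1 + (Real.cos k : ℂ)) * (q : ℂ) * z + 1)) ^ ((1 : ℂ) / 2)


section QuantumWalk

/-- The Fourier transform of the position distribution of `ψ` at coin value `n`. -/
def coinFourier (k : ℝ) (n : Fin 2) (ψ : QState) : ℂ :=
  ∑' x : ℤ, ((‖ψ (x, n)‖ ^ 2 : ℝ) : ℂ) * Complex.exp (Complex.I * k * x)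

/-- The sum over all measurement histories `j` of length `t` of the Fourier transform of the
distribution of the state obtained from `j` followed by `s` coherent steps. -/
def pathFourier (p k : ℝ) (s t : ℕ) (m n : Fin 2) : ℂ :=
  ∑' j : Fin t → Option (ℤ × Fin 2), coinFourier k n (hadamardStep^[s] (pathAmp p m t j))

theorem tsum_option_eq_add_tsum {α E : Type*} [NormedAddCommGroup E]
    {f : Option α → E} (hf : Summable fun a => f (some a)) :
    ∑' o, f o = f none + ∑' a, f (some a) := by
  have h1 : HasSum (f ∘ ((↑) : Set.range (some : α → Option α) → Option α))
      (∑' a, f (some a)) :=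
    ((Option.some_injective α).hasSum_range_iff (f := f)).2 hf.hasSum
  have h2 : HasSum (f ∘ ((↑) : ({none} : Set (Option α)) → Option α)) (f none) :=
    hasSum_unique (f ∘ ((↑) : ({none} : Set (Option α)) → Option α))
  rw [(HasSum.add_isCompl (Set.isCompl_range_some_none α) h1 h2).tsum_eq, add_comm]

theorem hadamardStep_smul (c : ℂ) (ψ : QState) :
    hadamardStep (c • ψ) = c • hadamardStep ψ := by
  ext v
  simp only [hadamardStep, Pi.smul_apply, smul_eq_mul]
  split_ifs <;> ring

theorem hadamardStep_iterate_smul (s : ℕ) (c : ℂ) (ψ : QState) :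
    hadamardStep^[s] (c • ψ) = c • hadamardStep^[s] ψ := by
  induction s generalizing ψ with
  | zero => rfl
  | succ s ih => simp only [Function.iterate_succ_apply, hadamardStep_smul, ih]

theorem hadamardStep_iterate_zero (s : ℕ) : hadamardStep^[s] (0 : QState) = 0 := by
  simpa using hadamardStep_iterate_smul s 0 0

theorem hadamardStep_translate (y : ℤ) (ψ : QState) :
    hadamardStep (fun v => ψ (v.1 - y, v.2)) = fun v => hadamardStep ψ (v.1 - y, v.2) := by
  ext v
  simp only [hadamardStep, sub_right_comm _ _ y, sub_add_eq_add_sub]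

theorem hadamardStep_iterate_translate (s : ℕ) (y : ℤ) (ψ : QState) :
    hadamardStep^[s] (fun v => ψ (v.1 - y, v.2)) =
      fun v => hadamardStep^[s] ψ (v.1 - y, v.2) := by
  induction s generalizing ψ with
  | zero => rfl
  | succ s ih => simp only [Function.iterate_succ_apply, hadamardStep_translate, ih]

theorem ket_eq_translate (y : ℤ) (l : Fin 2) :
    ket y l = fun v => ket 0 l (v.1 - y, v.2) := by
  ext v
  simp only [ket, Prod.ext_iff, sub_eq_zero]

theorem finite_support_ket (x : ℤ) (n : Fin 2) : (Function.support (ket x n)).Finite := by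
  refine (Set.finite_singleton (x, n)).subset fun v hv => ?_
  by_contra h
  exact hv (if_neg h)

theorem finite_support_hadamardStep {ψ : QState} (h : (Function.support ψ).Finite) :
    (Function.support (hadamardStep ψ)).Finite := by
  have key : Function.support (hadamardStep ψ) ⊆
      (fun v : ℤ × Fin 2 => (v.1 + 1, (0 : Fin 2))) '' Function.support ψ ∪
        (fun v : ℤ × Fin 2 => (v.1 - 1, (1 : Fin 2))) '' Function.support ψ := by
    rintro ⟨x, n⟩ hv
    by_contra hc
    simp only [Set.mem_union, Set.mem_image, Function.mem_support, not_or, not_exists, not_and,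
      Prod.forall] at hc
    apply hv
    fin_cases n
    · have h0 : ∀ l, ψ (x - 1, l) = 0 := fun l => by
        by_contra hl
        exact hc.1 _ _ hl (by simp)
      simp [hadamardStep, h0]
    · have h0 : ∀ l, ψ (x + 1, l) = 0 := fun l => by
        by_contra hl
        exact hc.2 _ _ hl (by simp)
      simp [hadamardStep, h0]
  exact ((h.image _).union (h.image _)).subset key

theorem finite_support_hadamardStep_iterate (s : ℕ) {ψ : QState}
    (h : (Function.support ψ).Finite) : (Function.support (hadamardStep^[s] ψ)).Finite := by
  induction s generalizing ψ with
  | zero => exact h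
  | succ s ih => exact ih (finite_support_hadamardStep h)

theorem measOp_none (p : ℝ) (ψ : QState) :
    measOp p none ψ = (Real.sqrt (1 - p) : ℂ) • ψ := rfl

theorem measOp_some (p : ℝ) (w : ℤ × Fin 2) (ψ : QState) :
    measOp p (some w) ψ = ((Real.sqrt p : ℂ) * ψ w) • ket w.1 w.2 := by
  ext v
  simp [measOp, ket]

theorem measOp_zero (p : ℝ) (o : Option (ℤ × Fin 2)) : measOp p o 0 = 0 := by
  cases o with
  | none => simp [measOp_none]
  | some w => simp [measOp_some]

theorem finite_support_measOp (p : ℝ) (o : Option (ℤ × Fin 2)) {ψ : QState}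
    (h : (Function.support ψ).Finite) : (Function.support (measOp p o ψ)).Finite := by
  cases o with
  | none =>
    rw [measOp_none]
    exact h.subset (Function.support_const_smul_subset _ _)
  | some w =>
    rw [measOp_some]
    exact (finite_support_ket _ _).subset (Function.support_const_smul_subset _ _)

theorem finite_support_pathAmp (p : ℝ) (m : Fin 2) (t : ℕ) (j : Fin t → Option (ℤ × Fin 2)) :
    (Function.support (pathAmp p m t j)).Finite := by
  induction t with
  | zero => exact finite_support_ket 0 m
  | succ t ih => exact finite_support_measOp p _ (finite_support_hadamardStep (ih _))

theorem finite_setOf_measOp_ne_zero (p : ℝ) {ψ : QState} (h : (Function.support ψ).Finite) :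
    {o | measOp p o ψ ≠ 0}.Finite := by
  refine ((h.image some).insert none).subset ?_
  rintro (_ | w) ho
  · exact Set.mem_insert _ _
  · refine Set.mem_insert_of_mem _ ⟨w, fun hw => ho ?_, rfl⟩
    rw [measOp_some, hw, mul_zero, zero_smul]

theorem finite_setOf_measOp_pathAmp_ne_zero (p : ℝ) (m : Fin 2) (t : ℕ)
    (h : {j | pathAmp p m t j ≠ 0}.Finite) :
    {a : (Fin t → Option (ℤ × Fin 2)) × Option (ℤ × Fin 2) |
      measOp p a.2 (hadamardStep (pathAmp p m t a.1)) ≠ 0}.Finite := by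
  refine (h.biUnion fun j _ => (Set.finite_singleton j).prod (finite_setOf_measOp_ne_zero p
    (finite_support_hadamardStep (finite_support_pathAmp p m t j)))).subset ?_
  rintro ⟨j, o⟩ ha
  simp only [Set.mem_iUnion, Set.mem_prod, Set.mem_singleton_iff]
  refine ⟨j, fun hj => ha ?_, rfl, ha⟩
  simp only [hj]
  rw [show hadamardStep 0 = 0 from hadamardStep_iterate_zero 1, measOp_zero]

theorem finite_setOf_pathAmp_ne_zero (p : ℝ) (m : Fin 2) (t : ℕ) :
    {j | pathAmp p m t j ≠ 0}.Finite := by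
  induction t with
  | zero => exact Set.toFinite _
  | succ t ih =>
    refine ((finite_setOf_measOp_pathAmp_ne_zero p m t ih).image
      fun a => Fin.snoc (α := fun _ => Option (ℤ × Fin 2)) a.1 a.2).subset fun j hj => ?_
    exact ⟨(Fin.init j, j (Fin.last t)), hj, Fin.snoc_init_self j⟩

theorem summable_pathAmp {E : Type*} [NormedAddCommGroup E] (p : ℝ) (m : Fin 2) (t : ℕ)
    {g : QState → E} (hg : g 0 = 0) : Summable fun j => g (pathAmp p m t j) := by
  refine summable_of_hasFiniteSupport ((finite_setOf_pathAmp_ne_zero p m t).subset fun j hj => ?_)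
  exact fun h => hj (by simp only [h, hg])

theorem tsum_pathAmp_succ {E : Type*} [NormedAddCommGroup E] [CompleteSpace E]
    (p : ℝ) (m : Fin 2) (t : ℕ) {g : QState → E} (hg : g 0 = 0) :
    ∑' j, g (pathAmp p m (t + 1) j) =
      ∑' j, (g (measOp p none (hadamardStep (pathAmp p m t j))) +
        ∑' w, g (measOp p (some w) (hadamardStep (pathAmp p m t j)))) := by
  have hs : Summable fun a : (Fin t → Option (ℤ × Fin 2)) × Option (ℤ × Fin 2) =>
      g (measOp p a.2 (hadamardStep (pathAmp p m t a.1))) :=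
    summable_of_hasFiniteSupport ((finite_setOf_measOp_pathAmp_ne_zero p m t
      (finite_setOf_pathAmp_ne_zero p m t)).subset fun a ha h => ha (by simp only [h, hg]))
  rw [← ((Equiv.prodComm _ _).trans
    (Fin.snocEquiv fun _ : Fin (t + 1) => Option (ℤ × Fin 2))).tsum_eq]
  have : ∀ a : (Fin t → Option (ℤ × Fin 2)) × Option (ℤ × Fin 2),
      pathAmp p m (t + 1) (((Equiv.prodComm _ _).trans
        (Fin.snocEquiv fun _ : Fin (t + 1) => Option (ℤ × Fin 2))) a) =
      measOp p a.2 (hadamardStep (pathAmp p m t a.1)) := fun a => by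
    simp [pathAmp, Fin.snocEquiv]
  simp only [this]
  rw [hs.tsum_prod]
  refine tsum_congr fun j => tsum_option_eq_add_tsum ?_
  exact (hs.prod_factor j).comp_injective (Option.some_injective _)

theorem summable_coin {E : Type*} [NormedAddCommGroup E] {ψ : QState}
    (h : (Function.support ψ).Finite) (n : Fin 2) {g : ℤ → ℂ → E} (hg : ∀ x, g x 0 = 0) :
    Summable fun x => g x (ψ (x, n)) := by
  refine summable_of_hasFiniteSupport ((h.image Prod.fst).subset fun x hx => ?_)
  exact ⟨(x, n), fun h0 => hx (by simp only [h0, hg]), rfl⟩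

theorem coinFourier_zero (k : ℝ) (n : Fin 2) : coinFourier k n 0 = 0 := by
  simp [coinFourier]

theorem coinFourier_smul (k : ℝ) (n : Fin 2) (c : ℂ) (ψ : QState) :
    coinFourier k n (c • ψ) = ((‖c‖ ^ 2 : ℝ) : ℂ) * coinFourier k n ψ := by
  simp only [coinFourier, ← tsum_mul_left, Pi.smul_apply, smul_eq_mul, norm_mul, mul_pow,
    Complex.ofReal_mul, mul_assoc]

theorem coinFourier_ket (k : ℝ) (n : Fin 2) (s : ℕ) (w : ℤ × Fin 2) :
    coinFourier k n (hadamardStep^[s] (ket w.1 w.2)) =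
      Complex.exp (Complex.I * k * w.1) * What w.2 n k s := by
  rw [ket_eq_translate, hadamardStep_iterate_translate, coinFourier, What, ← tsum_mul_left,
    ← (Equiv.addRight w.1).tsum_eq]
  refine tsum_congr fun x => ?_
  simp only [Equiv.coe_addRight, add_sub_cancel_right, W, Int.cast_add, mul_add, Complex.exp_add]
  ring

theorem tsum_fourier_mul (k : ℝ) {ψ : QState} (h : (Function.support ψ).Finite)
    (c : Fin 2 → ℂ) :
    ∑' w : ℤ × Fin 2, ((‖ψ w‖ ^ 2 : ℝ) : ℂ) * (Complex.exp (Complex.I * k * w.1) * c w.2) =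
      ∑ l, coinFourier k l ψ * c l := by
  have hs : Summable fun w : ℤ × Fin 2 =>
      ((‖ψ w‖ ^ 2 : ℝ) : ℂ) * (Complex.exp (Complex.I * k * w.1) * c w.2) :=
    summable_of_hasFiniteSupport (h.subset fun w hw h0 => hw (by simp [h0]))
  have hs' := (Equiv.prodComm (Fin 2) ℤ).summable_iff.2 hs
  rw [Function.comp_def] at hs'
  rw [← (Equiv.prodComm _ _).tsum_eq, hs'.tsum_prod, tsum_fintype]
  refine Finset.sum_congr rfl fun l _ => ?_
  simp only [coinFourier, ← tsum_mul_right, Equiv.prodComm_apply, Prod.swap_prod_mk, mul_assoc]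

theorem pathFourier_zero (p k : ℝ) (s : ℕ) (m n : Fin 2) :
    pathFourier p k s 0 m n = What m n k s := by
  rw [pathFourier, tsum_fintype, Fintype.sum_unique]
  rfl

theorem pathFourier_succ {p : ℝ} (hp0 : 0 ≤ p) (hp1 : p ≤ 1) (k : ℝ) (s t : ℕ) (m n : Fin 2) :
    pathFourier p k s (t + 1) m n = ((1 - p : ℝ) : ℂ) * pathFourier p k (s + 1) t m n +
      (p : ℂ) * ∑ l, pathFourier p k 1 t m l * What l n k s := by
  have hstep (r : ℕ) (l : Fin 2) :
      Summable fun j => coinFourier k l (hadamardStep^[r] (pathAmp p m t j)) :=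
    summable_pathAmp p m t (g := fun ψ => coinFourier k l (hadamardStep^[r] ψ))
      (by rw [hadamardStep_iterate_zero, coinFourier_zero])
  rw [pathFourier, tsum_pathAmp_succ p m t (g := fun ψ => coinFourier k n (hadamardStep^[s] ψ))
    (by rw [hadamardStep_iterate_zero, coinFourier_zero])]
  have hsome (j : Fin t → Option (ℤ × Fin 2)) :
      ∑' w, coinFourier k n (hadamardStep^[s]
        (measOp p (some w) (hadamardStep (pathAmp p m t j)))) =
      (p : ℂ) * ∑ l, coinFourier k l (hadamardStep^[1] (pathAmp p m t j)) * What l n k s := by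
    rw [← tsum_fourier_mul k (finite_support_hadamardStep_iterate 1
      (finite_support_pathAmp p m t j)), ← tsum_mul_left]
    refine tsum_congr fun w => ?_
    rw [measOp_some, hadamardStep_iterate_smul, coinFourier_smul, coinFourier_ket, norm_mul,
      mul_pow, Complex.norm_real, Real.norm_of_nonneg (Real.sqrt_nonneg p), Real.sq_sqrt hp0]
    push_cast
    rw [mul_assoc]
    rfl
  have hnone (j : Fin t → Option (ℤ × Fin 2)) :
      coinFourier k n (hadamardStep^[s] (measOp p none (hadamardStep (pathAmp p m t j)))) =
      ((1 - p : ℝ) : ℂ) * coinFourier k n (hadamardStep^[s + 1] (pathAmp p m t j)) := by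
    rw [measOp_none, hadamardStep_iterate_smul, coinFourier_smul, Complex.norm_real,
      Real.norm_of_nonneg (Real.sqrt_nonneg _), Real.sq_sqrt (by linarith),
      Function.iterate_succ_apply]
  simp only [hsome, hnone]
  rw [Summable.tsum_add ((hstep _ _).mul_left _)
    ((summable_sum fun l _ => (hstep 1 l).mul_right _).mul_left _), tsum_mul_left, tsum_mul_left,
    Summable.tsum_finsetSum fun l _ => (hstep 1 l).mul_right _]
  simp only [tsum_mul_right, pathFourier]

theorem tsum_Pdec_mul_exp (p k : ℝ) (t : ℕ) (m n : Fin 2) :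
    ∑' x : ℤ, (Pdec p m n x t : ℂ) * Complex.exp (Complex.I * k * x) =
      pathFourier p k 0 t m n := by
  simp only [pathFourier, coinFourier, Pdec, Complex.ofReal_tsum, ← tsum_mul_right,
    Function.iterate_zero, id_eq]
  refine Summable.tsum_comm (summable_of_hasFiniteSupport
    (((finite_setOf_pathAmp_ne_zero p m t).biUnion fun j _ => (Set.finite_singleton j).prod
      ((finite_support_pathAmp p m t j).image Prod.fst)).subset ?_))
  rintro ⟨j, x⟩ h
  simp only [Set.mem_iUnion, Set.mem_prod, Set.mem_singleton_iff]
  refine ⟨j, fun hj => h ?_, rfl, (x, n), fun hx => h ?_, rfl⟩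
  · simp [Function.uncurry, hj]
  · simp [Function.uncurry, hx]

theorem norm_exp_I_mul_mul_intCast (k : ℝ) (x : ℤ) : ‖Complex.exp (Complex.I * k * x)‖ = 1 := by
  have : Complex.I * k * x = ((k * x : ℝ) : ℂ) * Complex.I := by push_cast; ring
  rw [this, Complex.norm_exp_ofReal_mul_I]

theorem norm_coinFourier_le (k : ℝ) (n : Fin 2) {ψ : QState}
    (h : (Function.support ψ).Finite) : ‖coinFourier k n ψ‖ ≤ ∑' x, ‖ψ (x, n)‖ ^ 2 := by
  have hn : ∀ x : ℤ, ‖((‖ψ (x, n)‖ ^ 2 : ℝ) : ℂ) * Complex.exp (Complex.I * k * x)‖ =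
      ‖ψ (x, n)‖ ^ 2 := fun x => by
    rw [norm_mul, norm_exp_I_mul_mul_intCast, mul_one, Complex.norm_real,
      Real.norm_of_nonneg (sq_nonneg _)]
  have hs : Summable fun x : ℤ => ‖ψ (x, n)‖ ^ 2 :=
    summable_coin h n (g := fun _ c => ‖c‖ ^ 2) (by simp)
  refine (norm_tsum_le_tsum_norm (by simpa only [hn] using hs)).trans_eq ?_
  simp only [hn]

theorem sum_tsum_sq_hadamardStep {ψ : QState} (h : (Function.support ψ).Finite) :
    ∑ n, ∑' x, ‖hadamardStep ψ (x, n)‖ ^ 2 = ∑ n, ∑' x, ‖ψ (x, n)‖ ^ 2 := by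
  have hs (φ : QState) (hφ : (Function.support φ).Finite) (n : Fin 2) :
      Summable fun x : ℤ => ‖φ (x, n)‖ ^ 2 :=
    summable_coin hφ n (g := fun _ c => ‖c‖ ^ 2) (by simp)
  have hU := finite_support_hadamardStep h
  have h0 := (Equiv.addRight (1 : ℤ)).summable_iff.2 (hs _ hU 0)
  have h1 := (Equiv.subRight (1 : ℤ)).summable_iff.2 (hs _ hU 1)
  rw [Function.comp_def] at h0 h1
  simp only [Fin.sum_univ_two]
  rw [← (Equiv.addRight (1 : ℤ)).tsum_eq fun x => ‖hadamardStep ψ (x, 0)‖ ^ 2,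
    ← (Equiv.subRight (1 : ℤ)).tsum_eq fun x => ‖hadamardStep ψ (x, 1)‖ ^ 2,
    ← h0.tsum_add h1, ← Summable.tsum_add (hs _ h 0) (hs _ h 1)]
  refine tsum_congr fun x => ?_
  have h2 := parallelogram_law_with_norm ℝ (ψ (x, 0)) (ψ (x, 1))
  simp only [hadamardStep, Equiv.coe_addRight, Equiv.subRight_apply, if_true, one_ne_zero,
    if_false, add_sub_cancel_right, sub_add_cancel, norm_div, div_pow, Complex.norm_real,
    Real.norm_of_nonneg (Real.sqrt_nonneg 2), Real.sq_sqrt zero_le_two]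
  linarith

theorem sum_tsum_sq_hadamardStep_iterate (s : ℕ) {ψ : QState}
    (h : (Function.support ψ).Finite) :
    ∑ n, ∑' x, ‖hadamardStep^[s] ψ (x, n)‖ ^ 2 = ∑ n, ∑' x, ‖ψ (x, n)‖ ^ 2 := by
  induction s generalizing ψ with
  | zero => rfl
  | succ s ih =>
    rw [Function.iterate_succ_apply, ih (finite_support_hadamardStep h),
      sum_tsum_sq_hadamardStep h]

theorem tsum_sq_ket (m n : Fin 2) :
    ∑' x : ℤ, ‖ket 0 m (x, n)‖ ^ 2 = if n = m then 1 else 0 := by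
  rw [tsum_eq_single 0 fun x hx => by simp [ket, hx]]
  by_cases h : n = m <;> simp [ket, h]

theorem sum_norm_What_le_one (k : ℝ) (t : ℕ) (m : Fin 2) : ∑ n, ‖What m n k t‖ ≤ 1 := by
  refine (Finset.sum_le_sum fun n _ => norm_coinFourier_le k n
    (finite_support_hadamardStep_iterate t (finite_support_ket 0 m))).trans_eq ?_
  rw [sum_tsum_sq_hadamardStep_iterate t (finite_support_ket 0 m)]
  simp [tsum_sq_ket]

theorem What_zero (k : ℝ) (m n : Fin 2) : What m n k 0 = (1 : Matrix (Fin 2) (Fin 2) ℂ) m n := by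
  rw [What, tsum_eq_single 0 fun x hx => by simp [W, ket, hx], Matrix.one_apply]
  by_cases h : m = n <;> simp [W, ket, h, eq_comm (a := n)]


open scoped Matrix.Norms.Operator

/-- The Fourier transforms of the pure walk as a matrix. -/
def whatMat (k : ℝ) (t : ℕ) : Matrix (Fin 2) (Fin 2) ℂ := Matrix.of fun m n => What m n k t

/-- The coefficient matrix of `z ^ (t + 1)` in `Qmat p k z`. -/
def qCoeff (p k : ℝ) (t : ℕ) : Matrix (Fin 2) (Fin 2) ℂ :=
  ((p * (1 - p) ^ t : ℝ) : ℂ) • whatMat k (t + 1)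

/-- The coefficient matrix of `z ^ t` in `p • Pmat p k z + (1 - p) • 1`. -/
def renewalCoeff (p k : ℝ) (t : ℕ) : Matrix (Fin 2) (Fin 2) ℂ :=
  (p : ℂ) • Matrix.of (pathFourier p k 0 t) + if t = 0 then ((1 - p : ℝ) : ℂ) • 1 else 0

theorem norm_matrix_le_of_sum_le {A : Matrix (Fin 2) (Fin 2) ℂ} {c : ℝ} (hc : 0 ≤ c)
    (h : ∀ i, ∑ j, ‖A i j‖ ≤ c) : ‖A‖ ≤ c := by
  lift c to NNReal using hc
  rw [Matrix.linfty_opNorm_def]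
  refine NNReal.coe_le_coe.2 (Finset.sup_le fun i _ => ?_)
  rw [← NNReal.coe_le_coe]
  push_cast
  exact h i

theorem norm_entry_le_norm (A : Matrix (Fin 2) (Fin 2) ℂ) (i j : Fin 2) : ‖A i j‖ ≤ ‖A‖ := by
  rw [Matrix.linfty_opNorm_def, ← coe_nnnorm, NNReal.coe_le_coe]
  exact (Finset.single_le_sum (f := fun j => ‖A i j‖₊) (fun _ _ => zero_le)
    (Finset.mem_univ j)).trans
    (Finset.le_sup (f := fun i => ∑ j, ‖A i j‖₊) (Finset.mem_univ i))

theorem tsum_matrix_entry {f : ℕ → Matrix (Fin 2) (Fin 2) ℂ} (hf : Summable f) (i j : Fin 2) :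
    (∑' t, f t) i j = ∑' t, f t i j := by
  have h := Pi.hasSum.1 (Pi.hasSum.1 hf.hasSum i) j
  exact h.tsum_eq.symm

theorem norm_whatMat_le_one (k : ℝ) (t : ℕ) : ‖whatMat k t‖ ≤ 1 :=
  norm_matrix_le_of_sum_le zero_le_one fun m => sum_norm_What_le_one k t m

theorem whatMat_zero (k : ℝ) : whatMat k 0 = 1 := by
  ext m n
  exact What_zero k m n

theorem norm_qCoeff_le {p : ℝ} (hp0 : 0 ≤ p) (hp1 : p ≤ 1) (k : ℝ) (t : ℕ) :
    ‖qCoeff p k t‖ ≤ p * (1 - p) ^ t := by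
  have h : 0 ≤ p * (1 - p) ^ t := mul_nonneg hp0 (pow_nonneg (by linarith) t)
  rw [qCoeff, norm_smul, Complex.norm_real, Real.norm_of_nonneg h]
  exact mul_le_of_le_one_right h (norm_whatMat_le_one k _)

theorem pathFourier_matrix_succ {p : ℝ} (hp0 : 0 ≤ p) (hp1 : p ≤ 1) (k : ℝ) (s t : ℕ) :
    Matrix.of (pathFourier p k s (t + 1)) =
      ((1 - p : ℝ) : ℂ) • Matrix.of (pathFourier p k (s + 1) t) +
        (p : ℂ) • (Matrix.of (pathFourier p k 1 t) * whatMat k s) := by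
  ext m n
  simp only [Matrix.of_apply, Matrix.add_apply, Matrix.smul_apply, Matrix.mul_apply, smul_eq_mul,
    whatMat]
  exact pathFourier_succ hp0 hp1 k s t m n

theorem pathFourier_coherent_zero_succ {p : ℝ} (hp0 : 0 ≤ p) (hp1 : p ≤ 1) (k : ℝ) (t : ℕ) :
    Matrix.of (pathFourier p k 0 (t + 1)) = Matrix.of (pathFourier p k 1 t) := by
  rw [pathFourier_matrix_succ hp0 hp1, whatMat_zero, mul_one, ← add_smul]
  push_cast
  rw [sub_add_cancel, one_smul]

theorem pathFourier_matrix_zero (p k : ℝ) (s : ℕ) :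
    Matrix.of (pathFourier p k s 0) = whatMat k s := by
  ext m n
  exact pathFourier_zero p k s m n

theorem renewalCoeff_zero (p k : ℝ) : renewalCoeff p k 0 = 1 := by
  rw [renewalCoeff, pathFourier_matrix_zero, whatMat_zero, if_pos rfl, ← add_smul]
  push_cast
  rw [add_sub_cancel, one_smul]

theorem pathFourier_matrix_eq_sum {p : ℝ} (hp0 : 0 ≤ p) (hp1 : p ≤ 1) (k : ℝ) (s t : ℕ) :
    Matrix.of (pathFourier p k s t) = ∑ a ∈ Finset.HasAntidiagonal.antidiagonal t,
      renewalCoeff p k a.1 * (((1 - p : ℝ) : ℂ) ^ a.2 • whatMat k (s + a.2)) := by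
  induction t generalizing s with
  | zero =>
    simp [pathFourier_matrix_zero, renewalCoeff_zero]
  | succ t ih =>
    rw [pathFourier_matrix_succ hp0 hp1, ih (s + 1), ← pathFourier_coherent_zero_succ hp0 hp1,
      Finset.Nat.sum_antidiagonal_succ', add_comm, Finset.smul_sum, ← smul_mul_assoc]
    congr 1
    · simp [renewalCoeff]
    · refine Finset.sum_congr rfl fun a _ => ?_
      rw [← mul_smul_comm, smul_smul, pow_succ', add_right_comm, add_assoc]

theorem renewalCoeff_succ {p : ℝ} (hp0 : 0 ≤ p) (hp1 : p ≤ 1) (k : ℝ) (t : ℕ) :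
    renewalCoeff p k (t + 1) =
      ∑ a ∈ Finset.HasAntidiagonal.antidiagonal t, renewalCoeff p k a.1 * qCoeff p k a.2 := by
  rw [renewalCoeff, if_neg t.succ_ne_zero, add_zero, pathFourier_coherent_zero_succ hp0 hp1,
    pathFourier_matrix_eq_sum hp0 hp1, Finset.smul_sum]
  refine Finset.sum_congr rfl fun a _ => ?_
  rw [← mul_smul_comm, smul_smul, qCoeff, add_comm 1 a.2]
  push_cast
  rfl

theorem sum_antidiagonal_mul_pow (p : ℝ) (t : ℕ) :
    ∑ a ∈ Finset.HasAntidiagonal.antidiagonal t, p * (1 - p) ^ a.2 = 1 - (1 - p) ^ (t + 1) := by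
  induction t with
  | zero => simp
  | succ t ih =>
    rw [Finset.Nat.sum_antidiagonal_succ]
    simp only [ih]
    ring

theorem norm_renewalCoeff_le_one {p : ℝ} (hp0 : 0 ≤ p) (hp1 : p ≤ 1) (k : ℝ) (t : ℕ) :
    ‖renewalCoeff p k t‖ ≤ 1 := by
  induction t using Nat.strong_induction_on with
  | _ t ih =>
    cases t with
    | zero => rw [renewalCoeff_zero, norm_one]
    | succ t =>
      rw [renewalCoeff_succ hp0 hp1]
      calc _ ≤ ∑ a ∈ Finset.HasAntidiagonal.antidiagonal t, p * (1 - p) ^ a.2 := by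
            refine norm_sum_le_of_le _ fun a ha => (norm_mul_le _ _).trans ?_
            have h := ih a.1 (Nat.lt_succ_of_le (Nat.le.intro (Finset.HasAntidiagonal.mem_antidiagonal.1 ha)))
            have := mul_le_mul h (norm_qCoeff_le hp0 hp1 k a.2) (norm_nonneg _) zero_le_one
            rwa [one_mul] at this
        _ ≤ 1 := by
            rw [sum_antidiagonal_mul_pow]
            linarith [pow_nonneg (sub_nonneg.2 hp1) (t + 1)]

theorem summable_norm_pow_smul {E : Type*} [NormedAddCommGroup E] [NormedSpace ℂ E] {c : ℕ → E}
    {C ρ : ℝ} (hρ : 0 ≤ ρ) (hc : ∀ t, ‖c t‖ ≤ C * ρ ^ t) {z : ℂ} (hz : ρ * ‖z‖ < 1) :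
    Summable fun t => ‖z ^ t • c t‖ := by
  refine Summable.of_nonneg_of_le (fun _ => norm_nonneg _) (fun t => ?_)
    ((summable_geometric_of_lt_one (by positivity) hz).mul_left C)
  rw [norm_smul, norm_pow, mul_pow, mul_comm, ← mul_assoc]
  gcongr
  exact hc t

theorem analyticOnNhd_tsum_mul_pow {c : ℕ → ℂ} {C ρ : ℝ} (hρ : 0 ≤ ρ)
    (hc : ∀ t, ‖c t‖ ≤ C * ρ ^ t) :
    AnalyticOnNhd ℂ (fun z => ∑' t, c t * z ^ t) {z | ρ * ‖z‖ < 1} := by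
  intro z hz
  obtain ⟨r, hr, hzr⟩ : ∃ r, ρ * r < 1 ∧ ‖z‖ < r := by
    have h : ∀ᶠ r in nhdsWithin ‖z‖ (Set.Ioi ‖z‖), ρ * r < 1 :=
      nhdsWithin_le_nhds ((continuous_const.mul continuous_id).tendsto _ |>.eventually
        (gt_mem_nhds hz))
    exact (h.and self_mem_nhdsWithin).exists
  have hr0 : 0 ≤ r := (norm_nonneg z).trans hzr.le
  refine DifferentiableOn.analyticOnNhd (s := Metric.ball 0 r) ?_ Metric.isOpen_ball z
    (mem_ball_zero_iff.2 hzr)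
  refine Complex.differentiableOn_tsum_of_summable_norm (u := fun t => C * (ρ * r) ^ t)
    ((summable_geometric_of_lt_one (by positivity) hr).mul_left C) (fun t => by fun_prop)
    Metric.isOpen_ball fun t w hw => ?_
  rw [norm_mul, norm_pow, mul_pow, ← mul_assoc]
  have := mem_ball_zero_iff.1 hw
  have := (norm_nonneg _).trans (hc t)
  gcongr
  exact hc t

theorem norm_What_le_one (k : ℝ) (t : ℕ) (m n : Fin 2) : ‖What m n k t‖ ≤ 1 :=
  (norm_entry_le_norm (whatMat k t) m n).trans (norm_whatMat_le_one k t)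

theorem analyticOnNhd_Qhat {p : ℝ} (hp1 : p ≤ 1) (k : ℝ) (m n : Fin 2) :
    AnalyticOnNhd ℂ (fun z => Qhat p m n k z) {z | (1 - p) * ‖z‖ < 1} := by
  have h := analyticOnNhd_tsum_mul_pow (c := fun t => What m n k (t + 1) * ((1 - p : ℝ) : ℂ) ^ t)
    (C := 1) (sub_nonneg.2 hp1) fun t => by
      rw [norm_mul, norm_pow, Complex.norm_real, Real.norm_of_nonneg (sub_nonneg.2 hp1)]
      have := sub_nonneg.2 hp1
      gcongr
      exact norm_What_le_one k _ m n
  have heq : (fun z => Qhat p m n k z) = fun z => (p : ℂ) *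
      (z * ∑' t, What m n k (t + 1) * ((1 - p : ℝ) : ℂ) ^ t * z ^ t) := by
    ext z
    rw [Qhat]
    congr 1
    rw [← tsum_mul_left]
    exact tsum_congr fun t => by ring
  rw [heq]
  exact analyticOnNhd_const.mul (analyticOnNhd_id.mul h)

theorem summable_qCoeff {p : ℝ} (hp0 : 0 ≤ p) (hp1 : p ≤ 1) (k : ℝ) {z : ℂ} (hz : ‖z‖ < 1) :
    Summable fun t => ‖z ^ t • qCoeff p k t‖ :=
  summable_norm_pow_smul (sub_nonneg.2 hp1) (norm_qCoeff_le hp0 hp1 k) (by nlinarith [norm_nonneg z])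

theorem summable_renewalCoeff {p : ℝ} (hp0 : 0 ≤ p) (hp1 : p ≤ 1) (k : ℝ) {z : ℂ}
    (hz : ‖z‖ < 1) : Summable fun t => ‖z ^ t • renewalCoeff p k t‖ :=
  summable_norm_pow_smul (C := 1) zero_le_one
    (fun t => by simpa using norm_renewalCoeff_le_one hp0 hp1 k t) (by simpa using hz)

theorem Qmat_eq_tsum {p : ℝ} (hp0 : 0 ≤ p) (hp1 : p ≤ 1) (k : ℝ) {z : ℂ} (hz : ‖z‖ < 1) :
    Qmat p k z = z • ∑' t, z ^ t • qCoeff p k t := by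
  ext m n
  rw [Matrix.smul_apply, tsum_matrix_entry (summable_qCoeff hp0 hp1 k hz).of_norm, smul_eq_mul,
    ← tsum_mul_left, Qmat, Matrix.of_apply, Qhat, ← tsum_mul_left]
  refine tsum_congr fun t => ?_
  simp only [qCoeff, whatMat, Matrix.smul_apply, Matrix.of_apply, smul_eq_mul]
  push_cast
  ring

theorem tsum_renewalCoeff_mul_one_sub_Qmat {p : ℝ} (hp0 : 0 ≤ p) (hp1 : p ≤ 1) (k : ℝ) {z : ℂ}
    (hz : ‖z‖ < 1) : (∑' t, z ^ t • renewalCoeff p k t) * (1 - Qmat p k z) = 1 := by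
  have hR := summable_renewalCoeff hp0 hp1 k hz
  have hR' : Summable fun t => z ^ t • renewalCoeff p k t := hR.of_norm
  have hC : (∑' t, z ^ t • renewalCoeff p k t) * (∑' t, z ^ t • qCoeff p k t) =
      ∑' t, ∑ a ∈ Finset.HasAntidiagonal.antidiagonal t,
        (z ^ a.1 • renewalCoeff p k a.1) * (z ^ a.2 • qCoeff p k a.2) :=
    tsum_mul_tsum_eq_tsum_sum_antidiagonal_of_summable_norm hR (summable_qCoeff hp0 hp1 k hz)
  rw [mul_sub, mul_one, sub_eq_iff_eq_add, Qmat_eq_tsum hp0 hp1 k hz, mul_smul_comm, hC,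
    hR'.tsum_eq_zero_add, pow_zero, one_smul, renewalCoeff_zero, ← tsum_const_smul'']
  congr 1
  refine tsum_congr fun t => ?_
  rw [renewalCoeff_succ hp0 hp1, Finset.smul_sum, Finset.smul_sum]
  refine Finset.sum_congr rfl fun a ha => ?_
  rw [smul_mul_smul_comm, smul_smul, ← pow_add, Finset.HasAntidiagonal.mem_antidiagonal.1 ha, pow_succ']

theorem Phat_eq_tsum (p k : ℝ) (m n : Fin 2) (z : ℂ) :
    Phat p m n k z = ∑' t, pathFourier p k 0 t m n * z ^ t :=
  tsum_congr fun t => by rw [tsum_Pdec_mul_exp]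

theorem norm_mul_pathFourier_le_one {p : ℝ} (hp0 : 0 ≤ p) (hp1 : p ≤ 1) (k : ℝ) (t : ℕ)
    (m n : Fin 2) : ‖(p : ℂ) * pathFourier p k 0 t m n‖ ≤ 1 := by
  cases t with
  | zero =>
    rw [pathFourier_zero, norm_mul, Complex.norm_real, Real.norm_of_nonneg hp0]
    exact mul_le_one₀ hp1 (norm_nonneg _) (norm_What_le_one k 0 m n)
  | succ t =>
    have h := (norm_entry_le_norm (renewalCoeff p k (t + 1)) m n).trans
      (norm_renewalCoeff_le_one hp0 hp1 k (t + 1))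
    simpa [renewalCoeff] using h

theorem norm_pathFourier_le {p : ℝ} (hp0 : 0 < p) (hp1 : p ≤ 1) (k : ℝ) (t : ℕ)
    (m n : Fin 2) : ‖pathFourier p k 0 t m n‖ ≤ p⁻¹ * 1 ^ t := by
  have h := norm_mul_pathFourier_le_one hp0.le hp1 k t m n
  rw [norm_mul, Complex.norm_real, Real.norm_of_nonneg hp0.le] at h
  rw [one_pow, mul_one, ← one_div, le_div_iff₀ hp0]
  linarith

theorem analyticOnNhd_Phat {p : ℝ} (hp0 : 0 < p) (hp1 : p ≤ 1) (k : ℝ) (m n : Fin 2) :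
    AnalyticOnNhd ℂ (fun z => Phat p m n k z) (Metric.ball 0 1) := by
  simp only [Phat_eq_tsum]
  refine (analyticOnNhd_tsum_mul_pow zero_le_one fun t =>
    norm_pathFourier_le hp0 hp1 k t m n).mono fun z hz => ?_
  simpa using hz

theorem tsum_renewalCoeff {p : ℝ} (hp0 : 0 < p) (hp1 : p ≤ 1) (k : ℝ) {z : ℂ} (hz : ‖z‖ < 1) :
    ∑' t, z ^ t • renewalCoeff p k t = (p : ℂ) • Pmat p k z + ((1 - p : ℝ) : ℂ) • 1 := by
  ext m n
  have hs : Summable fun t => z ^ t • pathFourier p k 0 t m n :=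
    (summable_norm_pow_smul zero_le_one (fun t => norm_pathFourier_le hp0 hp1 k t m n)
      (by simpa using hz)).of_norm
  have hd : HasSum (fun t : ℕ => if t = 0 then ((1 - p : ℝ) : ℂ) * (1 : Matrix (Fin 2) (Fin 2) ℂ) m n
      else 0) (((1 - p : ℝ) : ℂ) * (1 : Matrix (Fin 2) (Fin 2) ℂ) m n) := hasSum_ite_eq 0 _
  rw [tsum_matrix_entry (summable_renewalCoeff hp0.le hp1 k hz).of_norm, Matrix.add_apply,
    Matrix.smul_apply, Matrix.smul_apply, Pmat, Matrix.of_apply, Phat_eq_tsum, smul_eq_mul,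
    smul_eq_mul, ← hd.tsum_eq, ← tsum_mul_left, ← Summable.tsum_add _ hd.summable]
  · refine tsum_congr fun t => ?_
    by_cases ht : t = 0
    · simp [renewalCoeff, ht]
    · simp [renewalCoeff, ht]
      ring
  · exact (hs.mul_left (p : ℂ)).congr fun t => by rw [smul_eq_mul, mul_comm (z ^ t)]

theorem det_smul_Pmat {p : ℝ} (hp0 : 0 < p) (hp1 : p ≤ 1) (k : ℝ) {z : ℂ} (hz : ‖z‖ < 1) :
    (1 - Qmat p k z).det ≠ 0 ∧
      (1 - Qmat p k z).det • ((p : ℂ) • Pmat p k z + ((1 - p : ℝ) : ℂ) • 1) =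
        (1 - Qmat p k z).adjugate := by
  have h := tsum_renewalCoeff_mul_one_sub_Qmat hp0.le hp1 k hz
  rw [tsum_renewalCoeff hp0 hp1 k hz] at h
  refine ⟨fun h0 => ?_, ?_⟩
  · have := congrArg Matrix.det h
    rw [Matrix.det_mul, h0, mul_zero, Matrix.det_one] at this
    exact zero_ne_one this
  · have := congrArg (· * (1 - Qmat p k z).adjugate) h
    simpa [mul_assoc, Matrix.mul_adjugate] using this

theorem Phat_eq_adjugate {p : ℝ} (hp0 : 0 < p) (hp1 : p ≤ 1) (k : ℝ) {z : ℂ} (hz : ‖z‖ < 1)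
    (m n : Fin 2) :
    Phat p m n k z = -(((1 - p) / p : ℝ) : ℂ) * (1 : Matrix (Fin 2) (Fin 2) ℂ) m n +
      (1 - Qmat p k z).adjugate m n / ((p : ℂ) * (1 - Qmat p k z).det) := by
  obtain ⟨h0, h⟩ := det_smul_Pmat hp0 hp1 k hz
  have hp : (p : ℂ) ≠ 0 := Complex.ofReal_ne_zero.2 hp0.ne'
  rw [← h]
  simp only [Matrix.smul_apply, Matrix.add_apply, smul_eq_mul, Pmat, Matrix.of_apply]
  push_cast
  field_simp
  ring

theorem analyticOnNhd_det_one_sub_Qmat {p : ℝ} (hp1 : p ≤ 1) (k : ℝ) :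
    AnalyticOnNhd ℂ (fun z => (1 - Qmat p k z).det) {z | (1 - p) * ‖z‖ < 1} := by
  have h (m n : Fin 2) := analyticOnNhd_Qhat hp1 k m n
  simp only [Matrix.det_fin_two, Matrix.sub_apply, Qmat, Matrix.of_apply]
  exact ((analyticOnNhd_const.sub (h 0 0)).mul (analyticOnNhd_const.sub (h 1 1))).sub
    ((analyticOnNhd_const.sub (h 0 1)).mul (analyticOnNhd_const.sub (h 1 0)))

theorem analyticOnNhd_adjugate_one_sub_Qmat {p : ℝ} (hp1 : p ≤ 1) (k : ℝ) (m n : Fin 2) :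
    AnalyticOnNhd ℂ (fun z => (1 - Qmat p k z).adjugate m n) {z | (1 - p) * ‖z‖ < 1} := by
  have h (m n : Fin 2) := analyticOnNhd_Qhat hp1 k m n
  simp only [Matrix.adjugate_fin_two, Matrix.sub_apply, Qmat, Matrix.of_apply]
  fin_cases m <;> fin_cases n
  · exact analyticOnNhd_const.sub (h 1 1)
  · exact (analyticOnNhd_const.sub (h 0 1)).neg
  · exact (analyticOnNhd_const.sub (h 1 0)).neg
  · exact analyticOnNhd_const.sub (h 0 0)

end QuantumWalk

/-- The four entrywise identities for `P̂_{m,n}(k,z)` in terms of `det(I - Q(k,z))`,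
and the fact that each `z ↦ P̂_{m,n}(k,z)`, analytic on the unit disk, extends to a
meromorphic function on the disk `{z : q·|z| < 1}` (i.e. `|z| < 1/q`). -/
theorem phat_identities_and_meromorphic_extension (k p q : ℝ)
    (hp0 : 0 < p) (hp1 : p ≤ 1) (hq : q = 1 - p) :
    (∀ z : ℂ, ‖z‖ < 1 →
      Phat p 0 0 k z
          = -((q / p : ℝ) : ℂ) + (1 - Qhat p 1 1 k z) / ((p : ℂ) * (1 - Qmat p k z).det) ∧
      Phat p 0 1 k z = Qhat p 0 1 k z / ((p : ℂ) * (1 - Qmat p k z).det) ∧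
      Phat p 1 0 k z = Qhat p 1 0 k z / ((p : ℂ) * (1 - Qmat p k z).det) ∧
      Phat p 1 1 k z
          = -((q / p : ℝ) : ℂ) + (1 - Qhat p 0 0 k z) / ((p : ℂ) * (1 - Qmat p k z).det)) ∧
    (∀ m n : Fin 2,
      AnalyticOnNhd ℂ (fun z => Phat p m n k z) (Metric.ball 0 1) ∧
      ∃ g : ℂ → ℂ, MeromorphicOn g {z : ℂ | q * ‖z‖ < 1} ∧
        Set.EqOn g (fun z => Phat p m n k z) (Metric.ball 0 1)) := by
  subst hq
  refine ⟨fun z hz => ?_, fun m n => ⟨analyticOnNhd_Phat hp0 hp1 k m n,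
    fun z => -(((1 - p) / p : ℝ) : ℂ) * (1 : Matrix (Fin 2) (Fin 2) ℂ) m n +
      (1 - Qmat p k z).adjugate m n / ((p : ℂ) * (1 - Qmat p k z).det), ?_, fun z hz => ?_⟩⟩
  · refine ⟨?_, ?_, ?_, ?_⟩ <;> rw [Phat_eq_adjugate hp0 hp1 k hz] <;>
      simp [Matrix.adjugate_fin_two, Qmat]
  · exact (MeromorphicOn.const _).add ((analyticOnNhd_adjugate_one_sub_Qmat hp1 k m n).meromorphicOn.div
      (analyticOnNhd_const.mul (analyticOnNhd_det_one_sub_Qmat hp1 k)).meromorphicOn)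
  · exact (Phat_eq_adjugate hp0 hp1 k (mem_ball_zero_iff.1 hz) m n).symm

end
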